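/- As T → ∞, the closed convex hull of the union over all initial conditions of the sets of occupational measures converges in the Hausdorff metric to the set of stationary measures: lim_{T→∞} ρ_H(cl co Γ_T, W) = 0, where Γ_T := ∪_{y0∈Y} Γ_T(y0). -/

import Mathlib

open MeasureTheory Filter Set Topology
open scoped ENNReal NNReal

noncomputable section

namespace StochLP

/-- The model of the controlled stochastic discrete time system (controlled stochastic
recursion) `y(t+1) = f(y(t), u(t), s(t))` from the paper: `Y ⊂ ℝⁿ` is a compact forward
invariant state constraint set, `Uc` is a compact metric control space, `S` is a Polish
noise space, `U` is an upper semicontinuous compact valued control constraint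
multifunction (upper semicontinuity of a compact valued map into a compact space being
recorded as closedness of its graph), `f` is bounded, continuous in `(y,u)` and Borel
measurable in `s`, and `ν` is the common law of the i.i.d. noise elements `s(t)`. -/
structure Model (n : ℕ) (Uc S : Type) [MetricSpace Uc] [CompactSpace Uc]
    [MeasurableSpace Uc] [BorelSpace Uc] [TopologicalSpace S] [PolishSpace S]
    [MeasurableSpace S] [BorelSpace S] where
  Y : Set (Fin n → ℝ)
  U : (Fin n → ℝ) → Set Uc
  f : (Fin n → ℝ) → Uc → S → (Fin n → ℝ)
  ν : Measure S
  ν_prob : IsProbabilityMeasure ν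
  Y_compact : IsCompact Y
  Y_nonempty : Y.Nonempty
  U_nonempty : ∀ y ∈ Y, (U y).Nonempty
  U_compact : ∀ y ∈ Y, IsCompact (U y)
  graph_closed : IsClosed {p : (Fin n → ℝ) × Uc | p.1 ∈ Y ∧ p.2 ∈ U p.1}
  f_bounded : ∃ C : ℝ, ∀ y ∈ Y, ∀ (u : Uc) (s : S), ‖f y u s‖ ≤ C
  f_cont : ∀ s : S, ContinuousOn (fun p : (Fin n → ℝ) × Uc => f p.1 p.2 s) (Y ×ˢ univ)
  f_meas : ∀ y ∈ Y, ∀ u : Uc, Measurable fun s => f y u s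
  f_inv : ∀ y ∈ Y, ∀ u ∈ U y, ∀ s : S, f y u s ∈ Y

variable {n : ℕ} {Uc S : Type} [MetricSpace Uc] [CompactSpace Uc] [MeasurableSpace Uc]
  [BorelSpace Uc] [TopologicalSpace S] [PolishSpace S] [MeasurableSpace S] [BorelSpace S]

/-- A control plan: a sequence of Borel measurable selections of the multifunction `U`. -/
structure Plan (M : Model n Uc S) where
  π : ℕ → (Fin n → ℝ) → Uc
  measurable : ∀ t, Measurable (π t)
  feasible : ∀ t, ∀ y ∈ M.Y, π t y ∈ M.U y

/-- The law of the state `y^{π,y₀}(t)` of the controlled stochastic recursion started at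
`y₀` and driven by the i.i.d. noise with common law `ν`, defined by the Markov recursion.  -/
def stateLaw (M : Model n Uc S) (t : ℕ) :
    (ℕ → (Fin n → ℝ) → Uc) → (Fin n → ℝ) → Measure (Fin n → ℝ) :=
  Nat.rec (motive := fun _ => (ℕ → (Fin n → ℝ) → Uc) → (Fin n → ℝ) → Measure (Fin n → ℝ))
    (fun _ y => Measure.dirac y)
    (fun _ ih π y =>
      (M.ν.map fun s => M.f y (π 0 y) s).bind fun y' => ih (fun j => π (j + 1)) y') t

/-- The joint law of the state-control pair `(y^{π,y₀}(t), u^{π,y₀}(t))`. -/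
def saLaw (M : Model n Uc S) (t : ℕ) (π : ℕ → (Fin n → ℝ) → Uc) (y0 : Fin n → ℝ) :
    Measure ((Fin n → ℝ) × Uc) :=
  (stateLaw M t π y0).map fun z => (z, π t z)

/-- `E[q(y^{π,y₀}(t), u^{π,y₀}(t))]`. -/
def expSA (M : Model n Uc S) (t : ℕ) (π : ℕ → (Fin n → ℝ) → Uc) (y0 : Fin n → ℝ)
    (q : (Fin n → ℝ) → Uc → ℝ) : ℝ :=
  ∫ p, q p.1 p.2 ∂saLaw M t π y0

/-- The finite horizon average expected cost `(1/T) E[Σ_{t=0}^{T-1} k(y(t),u(t))]`. -/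
def costT (M : Model n Uc S) (k : (Fin n → ℝ) → Uc → ℝ) (T : ℕ) (π : ℕ → (Fin n → ℝ) → Uc)
    (y0 : Fin n → ℝ) : ℝ :=
  (1 / (T : ℝ)) * ∑ t ∈ Finset.range T, expSA M t π y0 k

/-- The optimal value `v_T(y₀)` of the finite horizon problem. -/
def vT (M : Model n Uc S) (k : (Fin n → ℝ) → Uc → ℝ) (T : ℕ) (y0 : Fin n → ℝ) : ℝ :=
  ⨅ π : Plan M, costT M k T π.π y0

/-- The expected discounted cost `ε Σ_{t=0}^∞ (1-ε)^t E[k(y(t),u(t))]`. -/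
def costDisc (M : Model n Uc S) (k : (Fin n → ℝ) → Uc → ℝ) (ε : ℝ)
    (π : ℕ → (Fin n → ℝ) → Uc) (y0 : Fin n → ℝ) : ℝ :=
  ε * ∑' t : ℕ, (1 - ε) ^ t * expSA M t π y0 k

/-- The optimal value `h_ε(y₀)` of the discounted problem. -/
def hEps (M : Model n Uc S) (k : (Fin n → ℝ) → Uc → ℝ) (ε : ℝ) (y0 : Fin n → ℝ) : ℝ :=
  ⨅ π : Plan M, costDisc M k ε π.π y0

/-- The graph `G` of the multifunction `U`. -/
def graphG (M : Model n Uc S) : Set ((Fin n → ℝ) × Uc) := {p | p.1 ∈ M.Y ∧ p.2 ∈ M.U p.1}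

/-- `E[φ(f(y,u,s))]`, the expectation over the noise of `φ` evaluated after one step. -/
def Ef (M : Model n Uc S) (φ : (Fin n → ℝ) → ℝ) (y : Fin n → ℝ) (u : Uc) : ℝ :=
  ∫ s, φ (M.f y u s) ∂M.ν

/-- A measure on `Y × Uc` is concentrated on the graph `G` (this encodes measures defined
on Borel subsets of `G`). -/
def onG (M : Model n Uc S) (γ : Measure ((Fin n → ℝ) × Uc)) : Prop := γ (graphG M)ᶜ = 0

/-- The set `W` of stationary measures. -/
def Wset (M : Model n Uc S) : Set (Measure ((Fin n → ℝ) × Uc)) :=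
  {γ | IsProbabilityMeasure γ ∧ onG M γ ∧
    ∀ φ : (Fin n → ℝ) → ℝ, Continuous φ → ∫ p, (Ef M φ p.1 p.2 - φ p.1) ∂γ = 0}

/-- The set `W(ε, y₀)` of discounted stationary measures. -/
def Weps (M : Model n Uc S) (ε : ℝ) (y0 : Fin n → ℝ) : Set (Measure ((Fin n → ℝ) × Uc)) :=
  {γ | IsProbabilityMeasure γ ∧ onG M γ ∧
    ∀ φ : (Fin n → ℝ) → ℝ, Continuous φ →
      ∫ p, ((1 - ε) * (Ef M φ p.1 p.2 - φ p.1) + ε * (φ y0 - φ p.1)) ∂γ = 0}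

/-- The optimal value `k*(ε, y₀)` of the IDLP problem over `W(ε, y₀)`. -/
def kStarEps (M : Model n Uc S) (k : (Fin n → ℝ) → Uc → ℝ) (ε : ℝ) (y0 : Fin n → ℝ) : ℝ :=
  sInf ((fun γ : Measure ((Fin n → ℝ) × Uc) => ∫ p, k p.1 p.2 ∂γ) '' Weps M ε y0)

/-- The optimal value `k*` of the IDLP problem over `W`. -/
def kStar (M : Model n Uc S) (k : (Fin n → ℝ) → Uc → ℝ) : ℝ :=
  sInf ((fun γ : Measure ((Fin n → ℝ) × Uc) => ∫ p, k p.1 p.2 ∂γ) '' Wset M)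

/-- The optimal value `μ*(ε, y₀)` of the problem dual to the IDLP problem over `W(ε,y₀)`. -/
def muStarEps (M : Model n Uc S) (k : (Fin n → ℝ) → Uc → ℝ) (ε : ℝ) (y0 : Fin n → ℝ) : ℝ :=
  sSup {r : ℝ | ∃ ψ : (Fin n → ℝ) → ℝ, Continuous ψ ∧
    r = sInf ((fun p : (Fin n → ℝ) × Uc =>
      k p.1 p.2 + (1 - ε) * (Ef M ψ p.1 p.2 - ψ p.1) + ε * (ψ y0 - ψ p.1)) '' graphG M)}

/-- The optimal value `μ*` of the problem dual to the IDLP problem over `W`. -/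
def muStar (M : Model n Uc S) (k : (Fin n → ℝ) → Uc → ℝ) : ℝ :=
  sSup {r : ℝ | ∃ ψ : (Fin n → ℝ) → ℝ, Continuous ψ ∧
    r = sInf ((fun p : (Fin n → ℝ) × Uc => k p.1 p.2 + Ef M ψ p.1 p.2 - ψ p.1) '' graphG M)}

/-- The feasible set `Ω(y₀)` of the augmented IDLP problem. -/
def OmegaSet (M : Model n Uc S) (y0 : Fin n → ℝ) :
    Set (Measure ((Fin n → ℝ) × Uc) × Measure ((Fin n → ℝ) × Uc)) :=
  {p | p.1 ∈ Wset M ∧ IsFiniteMeasure p.2 ∧ onG M p.2 ∧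
    ∀ φ : (Fin n → ℝ) → ℝ, Continuous φ →
      ∫ q, (φ y0 - φ q.1) ∂p.1 + ∫ q, (Ef M φ q.1 q.2 - φ q.1) ∂p.2 = 0}

/-- The optimal value `k*(y₀)` of the augmented IDLP problem. -/
def kStarAug (M : Model n Uc S) (k : (Fin n → ℝ) → Uc → ℝ) (y0 : Fin n → ℝ) : ℝ :=
  sInf ((fun p : Measure ((Fin n → ℝ) × Uc) × Measure ((Fin n → ℝ) × Uc) =>
    ∫ q, k q.1 q.2 ∂p.1) '' OmegaSet M y0)

/-- Feasibility of `(μ, ψ, η)` for the problem dual to the augmented IDLP problem. -/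
def DualFeas (M : Model n Uc S) (k : (Fin n → ℝ) → Uc → ℝ) (y0 : Fin n → ℝ)
    (ψ η : (Fin n → ℝ) → ℝ) (μ : ℝ) : Prop :=
  (∀ p ∈ graphG M, 0 ≤ k p.1 p.2 + (ψ y0 - ψ p.1) + Ef M η p.1 p.2 - η p.1 - μ) ∧
  (∀ p ∈ graphG M, 0 ≤ Ef M ψ p.1 p.2 - ψ p.1)

/-- The optimal value `d*(y₀)` of the dual (with continuous test functions) of the
augmented IDLP problem. -/
def dStar (M : Model n Uc S) (k : (Fin n → ℝ) → Uc → ℝ) (y0 : Fin n → ℝ) : ℝ :=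
  sSup {μ : ℝ | ∃ ψ η : (Fin n → ℝ) → ℝ, Continuous ψ ∧ Continuous η ∧
    DualFeas M k y0 ψ η μ}

/-- Bounded Borel measurable real valued functions. -/
def BddBorel (ψ : (Fin n → ℝ) → ℝ) : Prop := Measurable ψ ∧ ∃ C : ℝ, ∀ y, |ψ y| ≤ C

/-- The optimal value `d̂*(y₀)` of the relaxed dual (with bounded Borel test functions) of
the augmented IDLP problem. -/
def dHatStar (M : Model n Uc S) (k : (Fin n → ℝ) → Uc → ℝ) (y0 : Fin n → ℝ) : ℝ :=
  sSup {μ : ℝ | ∃ ψ η : (Fin n → ℝ) → ℝ, BddBorel ψ ∧ BddBorel η ∧ DualFeas M k y0 ψ η μ}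

/-- The occupational measure `γ^{π,y₀,T}`. -/
def occT (M : Model n Uc S) (T : ℕ) (π : ℕ → (Fin n → ℝ) → Uc) (y0 : Fin n → ℝ) :
    Measure ((Fin n → ℝ) × Uc) :=
  (T : ℝ≥0∞)⁻¹ • ∑ t ∈ Finset.range T, saLaw M t π y0

/-- The discounted occupational measure `γ_d^{π,y₀,ε}`. -/
def discOcc (M : Model n Uc S) (ε : ℝ) (π : ℕ → (Fin n → ℝ) → Uc) (y0 : Fin n → ℝ) :
    Measure ((Fin n → ℝ) × Uc) :=
  ENNReal.ofReal ε • Measure.sum fun t : ℕ => ENNReal.ofReal (1 - ε) ^ t • saLaw M t π y0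

/-- The set `Θ_ε(y₀)` of discounted occupational measures, as a set of probability
measures (carrying the topology of weak convergence). -/
def ThetaEps (M : Model n Uc S) (ε : ℝ) (y0 : Fin n → ℝ) :
    Set (ProbabilityMeasure ((Fin n → ℝ) × Uc)) :=
  {μ | ∃ π : Plan M, μ.toMeasure = discOcc M ε π.π y0}

/-- `Θ_ε := ∪_{y₀ ∈ Y} Θ_ε(y₀)`. -/
def ThetaEpsAll (M : Model n Uc S) (ε : ℝ) : Set (ProbabilityMeasure ((Fin n → ℝ) × Uc)) :=
  ⋃ y0 ∈ M.Y, ThetaEps M ε y0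

/-- The set `Γ_T(y₀)` of occupational measures. -/
def GammaT (M : Model n Uc S) (T : ℕ) (y0 : Fin n → ℝ) :
    Set (ProbabilityMeasure ((Fin n → ℝ) × Uc)) :=
  {μ | ∃ π : Plan M, μ.toMeasure = occT M T π.π y0}

/-- `Γ_T := ∪_{y₀ ∈ Y} Γ_T(y₀)`. -/
def GammaTAll (M : Model n Uc S) (T : ℕ) : Set (ProbabilityMeasure ((Fin n → ℝ) × Uc)) :=
  ⋃ y0 ∈ M.Y, GammaT M T y0

/-- `W` as a set of probability measures. -/
def WsetPM (M : Model n Uc S) : Set (ProbabilityMeasure ((Fin n → ℝ) × Uc)) :=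
  {μ | μ.toMeasure ∈ Wset M}

/-- `W(ε,y₀)` as a set of probability measures. -/
def WepsPM (M : Model n Uc S) (ε : ℝ) (y0 : Fin n → ℝ) :
    Set (ProbabilityMeasure ((Fin n → ℝ) × Uc)) :=
  {μ | μ.toMeasure ∈ Weps M ε y0}

/-- The set of finite convex combinations of elements of a set of probability measures,
i.e. its convex hull. -/
def convexCombos {α : Type*} [MeasurableSpace α] (A : Set (ProbabilityMeasure α)) :
    Set (ProbabilityMeasure α) :=
  {μ | ∃ (m : ℕ) (w : Fin m → ℝ≥0) (γ : Fin m → ProbabilityMeasure α),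
    (∀ i, γ i ∈ A) ∧ (∑ i, w i) = 1 ∧
    μ.toMeasure = ∑ i, (w i : ℝ≥0∞) • (γ i).toMeasure}

/-- Membership in the set `D₁(y₀)`. -/
def D1mem (M : Model n Uc S) (y0 : Fin n → ℝ) (γ : Measure ((Fin n → ℝ) × Uc)) : Prop :=
  ∃ ξ : ℕ → Measure ((Fin n → ℝ) × Uc),
    (∀ l, IsFiniteMeasure (ξ l) ∧ onG M (ξ l)) ∧
    ∀ φ : (Fin n → ℝ) → ℝ, Continuous φ →
      Tendsto (fun l => ∫ q, (Ef M φ q.1 q.2 - φ q.1) ∂ξ l) atTop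
        (𝓝 (∫ q, (φ q.1 - φ y0) ∂γ))

/-- A control plan is periodic regime generating (PRG) for the initial point `y₀`. -/
def IsPRG (M : Model n Uc S) (π : Plan M) (y0 : Fin n → ℝ) : Prop :=
  ∃ T0 Tp : ℕ, 0 < Tp ∧
    ∀ q : ((Fin n → ℝ) × Uc) → ℝ, Continuous q →
      ∀ t, T0 ≤ t → ∫ p, q p ∂saLaw M t π.π y0 = ∫ p, q p ∂saLaw M (t + Tp) π.π y0

/-- The optimal value `V_per(y₀)` over periodic regime generating control plans. -/
def Vper (M : Model n Uc S) (k : (Fin n → ℝ) → Uc → ℝ) (y0 : Fin n → ℝ) : ℝ :=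
  sInf {c : ℝ | ∃ π : Plan M, IsPRG M π y0 ∧
    Tendsto (fun T => costT M k T π.π y0) atTop (𝓝 c)}

/-- The optimal value `k*_θ(y₀)` of the perturbed augmented IDLP problem. -/
def kStarTheta (M : Model n Uc S) (k θ : (Fin n → ℝ) → Uc → ℝ) (y0 : Fin n → ℝ) : ℝ :=
  sInf ((fun p : Measure ((Fin n → ℝ) × Uc) × Measure ((Fin n → ℝ) × Uc) =>
    ∫ q, k q.1 q.2 ∂p.1 + ∫ q, θ q.1 q.2 ∂p.2) '' OmegaSet M y0)

/-- Feasibility of `(μ, ψ, η)` for the perturbed dual problem. -/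
def DualFeasTheta (M : Model n Uc S) (k θ : (Fin n → ℝ) → Uc → ℝ) (y0 : Fin n → ℝ)
    (ψ η : (Fin n → ℝ) → ℝ) (μ : ℝ) : Prop :=
  (∀ p ∈ graphG M, 0 ≤ k p.1 p.2 + (ψ y0 - ψ p.1) + Ef M η p.1 p.2 - η p.1 - μ) ∧
  (∀ p ∈ graphG M, -θ p.1 p.2 ≤ Ef M ψ p.1 p.2 - ψ p.1)

/-- The optimal value `d*_θ(y₀)` of the perturbed dual problem. -/
def dStarTheta (M : Model n Uc S) (k θ : (Fin n → ℝ) → Uc → ℝ) (y0 : Fin n → ℝ) : ℝ :=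
  sSup {μ : ℝ | ∃ ψ η : (Fin n → ℝ) → ℝ, Continuous ψ ∧ Continuous η ∧
    DualFeasTheta M k θ y0 ψ η μ}

/-- The optimal value `d̄*_θ(y₀)` of the second form of the perturbed dual problem. -/
def dBarTheta (M : Model n Uc S) (k θ : (Fin n → ℝ) → Uc → ℝ) (y0 : Fin n → ℝ) : ℝ :=
  sSup {r : ℝ | ∃ ψ η : (Fin n → ℝ) → ℝ, Continuous ψ ∧ Continuous η ∧ r = ψ y0 ∧
    (∀ p ∈ graphG M, 0 ≤ k p.1 p.2 - ψ p.1 + Ef M η p.1 p.2 - η p.1) ∧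
    (∀ p ∈ graphG M, -θ p.1 p.2 ≤ Ef M ψ p.1 p.2 - ψ p.1)}

open ProbabilityTheory

section Kernels

variable (M : Model n Uc S)

lemma isClosed_graphG : IsClosed (graphG M) := M.graph_closed

lemma isCompact_graphG : IsCompact (graphG M) :=
  (M.Y_compact.prod isCompact_univ).of_isClosed_subset (isClosed_graphG M)
    fun _ hp => ⟨hp.1, mem_univ _⟩

lemma measurableSet_graphG : MeasurableSet (graphG M) := (isClosed_graphG M).measurableSet

open Classical in
/-- The dynamics, extended by the projection to the state off the graph `G`. -/
def extDyn (q : ((Fin n → ℝ) × Uc) × S) : Fin n → ℝ :=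
  if q.1 ∈ graphG M then M.f q.1.1 q.1.2 q.2 else q.1.1

variable {M} in
lemma extDyn_of_mem {p : (Fin n → ℝ) × Uc} (hp : p ∈ graphG M) (s : S) :
    extDyn M (p, s) = M.f p.1 p.2 s := if_pos hp

lemma measurable_extDyn : Measurable (extDyn M) := by
  have hs : MeasurableSet {q : ((Fin n → ℝ) × Uc) × S | q.1 ∈ graphG M} :=
    measurable_fst (measurableSet_graphG M)
  refine measurable_of_restrict_of_restrict_compl hs ?_ ?_
  · have h : Measurable (Function.uncurry fun (p : graphG M) (s : S) => M.f p.1.1 p.1.2 s) :=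
      measurable_uncurry_of_continuous_of_measurable
        (fun s => (M.f_cont s).comp_continuous continuous_subtype_val
          fun p => ⟨p.2.1, mem_univ _⟩)
        (fun p => M.f_meas _ p.2.1 _)
    have h' : Measurable fun q : {q : ((Fin n → ℝ) × Uc) × S | q.1 ∈ graphG M} =>
        ((⟨q.1.1, q.2⟩ : graphG M), q.1.2) := by
      exact ((measurable_fst.comp measurable_subtype_coe).subtype_mk).prodMk
        (measurable_snd.comp measurable_subtype_coe)
    convert h.comp h' using 1
    ext q : 1
    exact if_pos q.2
  · have h' : Measurable fun q : ↥({q : ((Fin n → ℝ) × Uc) × S | q.1 ∈ graphG M}ᶜ) =>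
        q.1.1.1 := by fun_prop
    convert h' using 1
    ext q : 1
    exact if_neg q.2

/-- The transition kernel of the controlled chain, as a kernel from state-control pairs. -/
def stepKernel : Kernel ((Fin n → ℝ) × Uc) (Fin n → ℝ) :=
  (Kernel.id ×ₖ Kernel.const _ M.ν).map (extDyn M)

lemma stepKernel_apply (p : (Fin n → ℝ) × Uc) :
    stepKernel M p = M.ν.map fun s => extDyn M (p, s) := by
  have := M.ν_prob
  rw [stepKernel, Kernel.map_apply _ (measurable_extDyn M), Kernel.prod_apply, Kernel.id_apply,
    Kernel.const_apply, Measure.dirac_prod, Measure.map_map (measurable_extDyn M) (by fun_prop)]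
  rfl

instance : IsMarkovKernel (stepKernel M) := by
  have := M.ν_prob
  exact Kernel.IsMarkovKernel.map _ (measurable_extDyn M)

variable {M}

lemma stepKernel_of_mem {p : (Fin n → ℝ) × Uc} (hp : p ∈ graphG M) :
    stepKernel M p = M.ν.map (M.f p.1 p.2) := by
  rw [stepKernel_apply]
  simp_rw [extDyn_of_mem hp]

lemma stepKernel_compl_Y {p : (Fin n → ℝ) × Uc} (hp : p ∈ graphG M) :
    stepKernel M p M.Yᶜ = 0 := by
  rw [stepKernel_of_mem hp,
    Measure.map_apply (M.f_meas _ hp.1 _) M.Y_compact.isClosed.measurableSet.compl]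
  convert measure_empty (μ := M.ν)
  ext s
  simpa using M.f_inv _ hp.1 _ hp.2 s

lemma integral_stepKernel {p : (Fin n → ℝ) × Uc} (hp : p ∈ graphG M) {φ : (Fin n → ℝ) → ℝ}
    (hφ : Continuous φ) : ∫ z, φ z ∂stepKernel M p = Ef M φ p.1 p.2 := by
  rw [stepKernel_of_mem hp, integral_map (M.f_meas _ hp.1 _).aemeasurable
    hφ.aestronglyMeasurable]
  rfl

/-- The plan used from time `1` on. -/
def Plan.shift (π : Plan M) : Plan M where
  π t := π.π (t + 1)
  measurable t := π.measurable (t + 1)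
  feasible t := π.feasible (t + 1)

/-- The state-control pair selected by a plan at a given time. -/
def Plan.graphMap (π : Plan M) (t : ℕ) (y : Fin n → ℝ) : (Fin n → ℝ) × Uc := (y, π.π t y)

@[fun_prop]
lemma Plan.measurable_graphMap (π : Plan M) (t : ℕ) : Measurable (π.graphMap t) :=
  measurable_id.prodMk (π.measurable t)

lemma Plan.graphMap_mem (π : Plan M) (t : ℕ) {y : Fin n → ℝ} (hy : y ∈ M.Y) :
    π.graphMap t y ∈ graphG M := ⟨hy, π.feasible t y hy⟩

/-- The one-step transition kernel at time `t` under a plan. -/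
def Plan.kernel (π : Plan M) (t : ℕ) : Kernel (Fin n → ℝ) (Fin n → ℝ) :=
  (stepKernel M).comap (π.graphMap t) (π.measurable_graphMap t)

instance (π : Plan M) (t : ℕ) : IsMarkovKernel (π.kernel t) := by
  unfold Plan.kernel; infer_instance

lemma Plan.kernel_apply (π : Plan M) (t : ℕ) (y : Fin n → ℝ) :
    π.kernel t y = stepKernel M (π.graphMap t y) := rfl

/-- The kernel sending an initial state to the law of the state at time `t`. -/
def stateKernel : ℕ → Plan M → Kernel (Fin n → ℝ) (Fin n → ℝ)
  | 0, _ => Kernel.id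
  | t + 1, π => stateKernel t π.shift ∘ₖ π.kernel 0

instance (t : ℕ) (π : Plan M) : IsMarkovKernel (stateKernel t π) := by
  induction t generalizing π with
  | zero => unfold stateKernel; infer_instance
  | succ t ih => have := ih π.shift; unfold stateKernel; infer_instance

lemma stateKernel_succ' (t : ℕ) (π : Plan M) :
    stateKernel (t + 1) π = π.kernel t ∘ₖ stateKernel t π := by
  induction t generalizing π with
  | zero => simp [stateKernel]
  | succ t ih =>
    rw [stateKernel, ih, Kernel.comp_assoc, stateKernel]
    rfl

lemma stateKernel_compl_Y (t : ℕ) (π : Plan M) {y : Fin n → ℝ} (hy : y ∈ M.Y) :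
    stateKernel t π y M.Yᶜ = 0 := by
  have hY : MeasurableSet M.Yᶜ := M.Y_compact.isClosed.measurableSet.compl
  induction t with
  | zero => simp [stateKernel, Kernel.id_apply, Measure.dirac_apply' _ hY, hy]
  | succ t ih =>
    rw [stateKernel_succ', Kernel.comp_apply' _ _ _ hY]
    refine lintegral_eq_zero_of_ae_eq_zero ?_
    filter_upwards [show ∀ᵐ z ∂stateKernel t π y, z ∈ M.Y from ih] with z hz
    exact stepKernel_compl_Y (π.graphMap_mem t hz)

lemma stateLaw_eq_stateKernel (t : ℕ) (π : Plan M) {y : Fin n → ℝ} (hy : y ∈ M.Y) :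
    stateLaw M t π.π y = stateKernel t π y := by
  induction t generalizing π y with
  | zero => simp [stateLaw, stateKernel, Kernel.id_apply]
  | succ t ih =>
    have h1 : M.ν.map (fun s => M.f y (π.π 0 y) s) = π.kernel 0 y :=
      (stepKernel_of_mem (π.graphMap_mem 0 hy)).symm
    change (M.ν.map fun s => M.f y (π.π 0 y) s).bind (stateLaw M t π.shift.π) = _
    rw [stateKernel, Kernel.comp_apply, h1]
    refine Measure.bind_congr_right ?_
    have h2 : ∀ᵐ z ∂π.kernel 0 y, z ∈ M.Y := stepKernel_compl_Y (π.graphMap_mem 0 hy)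
    filter_upwards [h2] with z hz using ih π.shift hz

lemma saLaw_eq (t : ℕ) (π : Plan M) {y : Fin n → ℝ} (hy : y ∈ M.Y) :
    saLaw M t π.π y = (stateKernel t π y).map (π.graphMap t) := by
  rw [saLaw, stateLaw_eq_stateKernel t π hy]
  rfl

lemma isProbabilityMeasure_saLaw (t : ℕ) (π : Plan M) {y : Fin n → ℝ} (hy : y ∈ M.Y) :
    IsProbabilityMeasure (saLaw M t π.π y) := by
  rw [saLaw_eq t π hy]
  exact Measure.isProbabilityMeasure_map (π.measurable_graphMap t).aemeasurable

lemma saLaw_onG (t : ℕ) (π : Plan M) {y : Fin n → ℝ} (hy : y ∈ M.Y) :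
    onG M (saLaw M t π.π y) := by
  rw [onG, saLaw_eq t π hy, Measure.map_apply (π.measurable_graphMap t)
    (measurableSet_graphG M).compl]
  refine measure_mono_null ?_ (stateKernel_compl_Y t π hy)
  exact fun z hz hz' => hz (π.graphMap_mem t hz')

lemma isProbabilityMeasure_occT {T : ℕ} (hT : T ≠ 0) (π : Plan M) {y : Fin n → ℝ}
    (hy : y ∈ M.Y) : IsProbabilityMeasure (occT M T π.π y) := by
  have h (t : ℕ) : saLaw M t π.π y univ = 1 := (isProbabilityMeasure_saLaw t π hy).measure_univ
  refine ⟨?_⟩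
  simp [occT, h, ENNReal.inv_mul_cancel (Nat.cast_ne_zero.2 hT) (ENNReal.natCast_ne_top T)]

lemma occT_onG (T : ℕ) (π : Plan M) {y : Fin n → ℝ} (hy : y ∈ M.Y) :
    onG M (occT M T π.π y) := by
  have h (t : ℕ) : saLaw M t π.π y (graphG M)ᶜ = 0 := saLaw_onG t π hy
  simp [onG, occT, h]

lemma integral_occT (T : ℕ) (π : Plan M) {y : Fin n → ℝ} (hy : y ∈ M.Y)
    {k : (Fin n → ℝ) × Uc → ℝ} (hk : Measurable k) {C : ℝ} (hC : ∀ p, ‖k p‖ ≤ C) :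
    ∫ p, k p ∂occT M T π.π y =
      (T : ℝ)⁻¹ * ∑ t ∈ Finset.range T, ∫ z, k (π.graphMap t z) ∂stateKernel t π y := by
  rw [occT, integral_smul_measure, integral_finsetSum_measure]
  · simp only [ENNReal.toReal_inv, ENNReal.toReal_natCast, smul_eq_mul]
    congr 1
    refine Finset.sum_congr rfl fun t _ => ?_
    rw [saLaw_eq t π hy, integral_map (by fun_prop) hk.aestronglyMeasurable]
  · intro t _
    have := isProbabilityMeasure_saLaw t π hy
    exact Integrable.of_bound hk.aestronglyMeasurable C (.of_forall hC)

end Kernels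

section Selection

lemma integral_measure_comp {α β : Type*} [MeasurableSpace α] [MeasurableSpace β]
    {κ : Kernel α β} {μ : Measure α} {f : β → ℝ} (hf : Integrable f (κ ∘ₘ μ)) :
    ∫ b, f b ∂(κ ∘ₘ μ) = ∫ a, ∫ b, f b ∂κ a ∂μ := by
  rw [Measure.comp_eq_comp_const_apply] at hf ⊢
  rw [Kernel.integral_comp hf, Kernel.const_apply]

variable {M : Model n Uc S}

lemma exists_selection_integral_le {σ : (Fin n → ℝ) → Uc} (hσ : Measurable σ)
    (hσU : ∀ y ∈ M.Y, σ y ∈ M.U y) {γ : Measure ((Fin n → ℝ) × Uc)} [IsProbabilityMeasure γ]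
    (hγ : onG M γ) {h : (Fin n → ℝ) × Uc → ℝ} (hh : Measurable h) {C : ℝ}
    (hC : ∀ p, ‖h p‖ ≤ C) :
    ∃ τ : (Fin n → ℝ) → Uc, Measurable τ ∧ (∀ y ∈ M.Y, τ y ∈ M.U y) ∧
      ∫ y, h (y, τ y) ∂γ.fst ≤ ∫ p, h p ∂γ := by
  classical
  have : Nonempty Uc := ⟨σ 0⟩
  obtain ⟨g, hg, hgκ⟩ := Kernel.exists_measurable_map_eq_unitInterval γ.condKernel
  have hpair : Measurable fun q : (Fin n → ℝ) × unitInterval => (q.1, g q.1 q.2) :=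
    measurable_fst.prodMk hg
  have hγg : γ = (γ.fst.prod volume).map fun q => (q.1, g q.1 q.2) := by
    conv_lhs => rw [← γ.disintegrate γ.condKernel]
    ext s hs
    rw [Measure.compProd_apply hs, Measure.map_apply hpair hs, Measure.prod_apply (hpair hs)]
    refine lintegral_congr fun y => ?_
    rw [← hgκ, Measure.map_apply (f := g y) (hg.comp measurable_prodMk_left)
      (measurable_prodMk_left hs)]
    rfl
  let τ (q : (Fin n → ℝ) × unitInterval) : Uc :=
    if (q.1, g q.1 q.2) ∈ graphG M then g q.1 q.2 else σ q.1
  have hτ : Measurable τ :=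
    Measurable.ite (hpair (measurableSet_graphG M)) hg (hσ.comp measurable_fst)
  have hτU (y : Fin n → ℝ) (hy : y ∈ M.Y) (ω : unitInterval) : τ (y, ω) ∈ M.U y := by
    by_cases hq : (y, g y ω) ∈ graphG M
    · simpa only [τ, if_pos hq] using hq.2
    · simpa only [τ, if_neg hq] using hσU y hy
  have hτh : Measurable fun q : (Fin n → ℝ) × unitInterval => h (q.1, τ q) :=
    hh.comp (measurable_fst.prodMk hτ)
  have hint : Integrable (fun q : (Fin n → ℝ) × unitInterval => h (q.1, τ q))
      (γ.fst.prod volume) := .of_bound hτh.aestronglyMeasurable C (.of_forall fun _ => hC _)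
  have hG : ∀ᵐ q ∂γ.fst.prod (volume : Measure unitInterval), (q.1, g q.1 q.2) ∈ graphG M := by
    have : ∀ᵐ p ∂γ, p ∈ graphG M := hγ
    rw [hγg] at this
    exact ae_of_ae_map hpair.aemeasurable this
  have heq : ∫ p, h p ∂γ = ∫ ω, ∫ y, h (y, τ (y, ω)) ∂γ.fst := by
    conv_lhs => rw [hγg]
    rw [integral_map hpair.aemeasurable hh.aestronglyMeasurable, ← integral_prod_symm _ hint]
    refine integral_congr_ae ?_
    filter_upwards [hG] with q hq
    simp only [τ, if_pos hq]
  obtain ⟨ω, hω⟩ := exists_le_integral (μ := (volume : Measure unitInterval))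
    hint.integral_prod_right
  exact ⟨fun y => τ (y, ω), hτ.comp measurable_prodMk_right, fun y hy => hτU y hy ω,
    hω.trans_eq heq.symm⟩

/-- The total expected cost over the first `T` steps. -/
def totalCost (k : (Fin n → ℝ) × Uc → ℝ) (T : ℕ) (π : Plan M) (y : Fin n → ℝ) : ℝ :=
  ∑ t ∈ Finset.range T, ∫ z, k (π.graphMap t z) ∂stateKernel t π y

variable {k : (Fin n → ℝ) × Uc → ℝ} (hk : Measurable k) {C : ℝ} (hC : ∀ p, ‖k p‖ ≤ C)
include hk

lemma measurable_totalCost (T : ℕ) (π : Plan M) : Measurable (totalCost k T π) :=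
  Finset.measurable_sum _ fun t _ =>
    (StronglyMeasurable.integral_kernel
      (hk.comp (π.measurable_graphMap t)).stronglyMeasurable).measurable

omit hk in
include hC in
lemma norm_totalCost_le (T : ℕ) (π : Plan M) (y : Fin n → ℝ) :
    ‖totalCost k T π y‖ ≤ T * C := by
  have h := norm_sum_le_of_le (Finset.range T)
    (f := fun t => ∫ z, k (π.graphMap t z) ∂stateKernel t π y) (n := fun _ => C) fun t _ => ?_
  · simpa [totalCost] using h
  refine (norm_integral_le_of_norm_le_const (.of_forall fun z => hC (π.graphMap t z))).trans ?_
  simp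

include hC in
lemma integrable_totalCost (T : ℕ) (π : Plan M) (μ : Measure (Fin n → ℝ)) [IsFiniteMeasure μ] :
    Integrable (totalCost k T π) μ :=
  .of_bound (measurable_totalCost hk T π).aestronglyMeasurable (T * C)
    (.of_forall (norm_totalCost_le hC T π))

include hC in
lemma totalCost_succ (T : ℕ) (π : Plan M) (y : Fin n → ℝ) :
    totalCost k (T + 1) π y =
      k (π.graphMap 0 y) + ∫ w, totalCost k T π.shift w ∂π.kernel 0 y := by
  have hbd (t : ℕ) (μ : Measure (Fin n → ℝ)) [IsFiniteMeasure μ] :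
      Integrable (fun z => k (π.graphMap t z)) μ :=
    .of_bound (hk.comp (π.measurable_graphMap t)).aestronglyMeasurable C
      (.of_forall fun _ => hC _)
  simp only [totalCost]
  rw [Finset.sum_range_succ', add_comm, integral_finsetSum]
  · congr 1
    · rw [stateKernel, Kernel.id_apply,
        integral_dirac' (fun z => k (π.graphMap 0 z)) _
          (hk.comp (π.measurable_graphMap 0)).stronglyMeasurable]
    · refine Finset.sum_congr rfl fun t _ => ?_
      rw [stateKernel, Kernel.integral_comp (hbd _ _)]
      rfl
  · intro t _
    refine .of_bound (StronglyMeasurable.integral_kernel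
      (hk.comp (π.shift.measurable_graphMap t)).stronglyMeasurable).aestronglyMeasurable C
      (.of_forall fun w => ?_)
    refine (norm_integral_le_of_norm_le_const (.of_forall fun z => hC _)).trans ?_
    simp

omit hk in
lemma stepKernel_comp_eq_fst {γ : Measure ((Fin n → ℝ) × Uc)} (hγ : γ ∈ Wset M) :
    stepKernel M ∘ₘ γ = γ.fst := by
  obtain ⟨hp, hG, hst⟩ := hγ
  refine ext_of_forall_integral_eq_of_IsFiniteMeasure fun φ => ?_
  have hφP : Integrable (fun p => ∫ z, φ z ∂stepKernel M p) γ := by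
    refine .of_bound (StronglyMeasurable.integral_kernel
      φ.continuous.stronglyMeasurable).aestronglyMeasurable ‖φ‖ (.of_forall fun p => ?_)
    refine (norm_integral_le_of_norm_le_const (.of_forall fun z => φ.norm_coe_le_norm z)).trans ?_
    simp
  have hφ : Integrable (fun p : (Fin n → ℝ) × Uc => φ p.1) γ :=
    .of_bound (φ.continuous.comp continuous_fst).aestronglyMeasurable ‖φ‖
      (.of_forall fun p => φ.norm_coe_le_norm _)
  have h := hst φ φ.continuous
  have hae : (fun p : (Fin n → ℝ) × Uc => Ef M φ p.1 p.2 - φ p.1) =ᵐ[γ]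
      fun p => ∫ z, φ z ∂stepKernel M p - φ p.1 := by
    filter_upwards [show ∀ᵐ p ∂γ, p ∈ graphG M from hG] with p hp
    rw [integral_stepKernel hp φ.continuous]
  rw [integral_congr_ae hae, integral_sub hφP hφ, sub_eq_zero] at h
  rw [integral_measure_comp (φ.integrable _), h, Measure.fst,
    integral_map measurable_fst.aemeasurable φ.continuous.aestronglyMeasurable]

/-- The plan using a given selection at time `0` and another plan afterwards. -/
def Plan.cons (τ : (Fin n → ℝ) → Uc) (hτ : Measurable τ) (hτU : ∀ y ∈ M.Y, τ y ∈ M.U y)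
    (π : Plan M) : Plan M where
  π t := Nat.casesOn t τ π.π
  measurable t := by cases t with
    | zero => exact hτ
    | succ t => exact π.measurable t
  feasible t := by cases t with
    | zero => exact hτU
    | succ t => exact π.feasible t

include hC in
lemma exists_plan_integral_totalCost_le [Nonempty (Plan M)] {γ : Measure ((Fin n → ℝ) × Uc)}
    (hγ : γ ∈ Wset M) (T : ℕ) :
    ∃ π : Plan M, ∫ y, totalCost k T π y ∂γ.fst ≤ T * ∫ p, k p ∂γ := by
  have hp : IsProbabilityMeasure γ := hγ.1
  induction T with
  | zero => exact ⟨Classical.arbitrary _, by simp [totalCost]⟩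
  | succ T ih =>
    obtain ⟨π, hπ⟩ := ih
    have hJ : Measurable fun p => ∫ z, totalCost k T π z ∂stepKernel M p :=
      (StronglyMeasurable.integral_kernel
        (measurable_totalCost hk T π).stronglyMeasurable).measurable
    have hJC (p) : ‖∫ z, totalCost k T π z ∂stepKernel M p‖ ≤ T * C := by
      refine (norm_integral_le_of_norm_le_const
        (.of_forall fun z => norm_totalCost_le hC T π z)).trans ?_
      simp
    obtain ⟨τ, hτ, hτU, hle⟩ := exists_selection_integral_le (π.measurable 0) (π.feasible 0)
      hγ.2.1 (hk.add hJ) (C := C + T * C) fun p => norm_add_le_of_le (hC p) (hJC p)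
    refine ⟨π.cons τ hτ hτU, ?_⟩
    have h1 : ∫ y, totalCost k (T + 1) (π.cons τ hτ hτU) y ∂γ.fst ≤
        ∫ p, (k p + ∫ z, totalCost k T π z ∂stepKernel M p) ∂γ := by
      simp_rw [totalCost_succ hk hC]
      exact hle
    rw [integral_add (.of_bound hk.aestronglyMeasurable C (.of_forall hC))
      (.of_bound hJ.aestronglyMeasurable (T * C) (.of_forall hJC)),
      ← integral_measure_comp (integrable_totalCost hk hC T π _), stepKernel_comp_eq_fst hγ] at h1
    push_cast
    linarith

include hC in
lemma exists_integral_occT_le [Nonempty (Plan M)] {γ : Measure ((Fin n → ℝ) × Uc)}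
    (hγ : γ ∈ Wset M) {T : ℕ} (hT : T ≠ 0) :
    ∃ π : Plan M, ∃ y ∈ M.Y, ∫ p, k p ∂occT M T π.π y ≤ ∫ p, k p ∂γ := by
  have hp : IsProbabilityMeasure γ := hγ.1
  obtain ⟨π, hπ⟩ := exists_plan_integral_totalCost_le hk hC hγ T
  have hY : γ.fst M.Yᶜ = 0 := by
    rw [Measure.fst_apply M.Y_compact.isClosed.measurableSet.compl]
    refine measure_mono_null ?_ hγ.2.1
    exact fun p hp hp' => hp hp'.1
  obtain ⟨y, hy, hle⟩ := exists_notMem_null_le_integral (integrable_totalCost hk hC T π γ.fst) hY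
  refine ⟨π, y, by simpa using hy, ?_⟩
  rw [integral_occT T π (by simpa using hy) hk hC, inv_mul_le_iff₀ (by positivity)]
  exact hle.trans hπ

end Selection

section ConvexHull

variable {Ω : Type*} [MeasurableSpace Ω] [TopologicalSpace Ω] [OpensMeasurableSpace Ω]

open BoundedContinuousFunction

lemma mem_closure_of_integral_mem_closure {A : Set (ProbabilityMeasure Ω)}
    {μ : ProbabilityMeasure Ω}
    (h : (fun k : Ω →ᵇ ℝ => ∫ x, k x ∂(μ : Measure Ω)) ∈
      closure ((fun (ν : ProbabilityMeasure Ω) (k : Ω →ᵇ ℝ) => ∫ x, k x ∂(ν : Measure Ω)) '' A)) :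
    μ ∈ closure A := by
  set Φ : ProbabilityMeasure Ω → (Ω →ᵇ ℝ) → ℝ := fun ν k => ∫ x, k x ∂(ν : Measure Ω)
  have hΦ : IsInducing Φ := by
    refine isInducing_iff_nhds.2 fun ν => le_antisymm ?_ ?_
    · refine map_le_iff_le_comap.1 (tendsto_pi_nhds.2 fun k => ?_)
      exact ProbabilityMeasure.tendsto_iff_forall_integral_tendsto.1 tendsto_id k
    · exact tendsto_id'.1 (ProbabilityMeasure.tendsto_iff_forall_integral_tendsto.2
        (tendsto_pi_nhds.1 tendsto_comap))
  rw [hΦ.closure_eq_preimage_closure_image]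
  exact h

lemma exists_convexCombos_of_mem_convexHull {ι : Type*} {A : Set (ProbabilityMeasure Ω)}
    {k : ι → Ω →ᵇ ℝ} {z : ι → ℝ}
    (hz : z ∈ convexHull ℝ
      ((fun (ν : ProbabilityMeasure Ω) (i : ι) => ∫ x, k i x ∂(ν : Measure Ω)) '' A)) :
    ∃ ν ∈ convexCombos A, ∀ i, ∫ x, k i x ∂(ν : Measure Ω) = z i := by
  obtain ⟨J, _, w, y, hw, hw1, hy, rfl⟩ := mem_convexHull_iff_exists_fintype.1 hz
  choose γ hγA hγ using hy
  let e := Fintype.equivFin J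
  have hsum : ∑ j, (w (e.symm j)).toNNReal = 1 := by
    rw [← NNReal.coe_inj]
    push_cast
    simp_rw [Real.coe_toNNReal _ (hw _)]
    rw [e.symm.sum_comp w, hw1]
  have hprob : IsProbabilityMeasure
      (∑ j, ((w (e.symm j)).toNNReal : ℝ≥0∞) • (γ (e.symm j) : Measure Ω)) := by
    refine ⟨?_⟩
    simp only [Measure.coe_finsetSum, Finset.sum_apply, Measure.smul_apply, measure_univ,
      smul_eq_mul, mul_one]
    exact_mod_cast hsum
  refine ⟨⟨_, hprob⟩, ⟨_, fun j => (w (e.symm j)).toNNReal, fun j => γ (e.symm j),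
    fun j => hγA _, hsum, rfl⟩, fun i => ?_⟩
  simp only [ProbabilityMeasure.coe_mk]
  rw [integral_finsetSum_measure fun j _ =>
    ((k i).integrable (γ (e.symm j) : Measure Ω)).smul_measure ENNReal.coe_ne_top]
  simp only [integral_smul_measure, ENNReal.coe_toReal, Real.coe_toNNReal _ (hw _)]
  rw [e.symm.sum_comp fun j => w j • ∫ x, k i x ∂(γ j : Measure Ω)]
  simp [← hγ]

lemma mem_closure_convexCombos {A : Set (ProbabilityMeasure Ω)} {μ : ProbabilityMeasure Ω}
    (h : ∀ k : Ω →ᵇ ℝ, ∃ ν ∈ A, ∫ x, k x ∂(ν : Measure Ω) ≤ ∫ x, k x ∂(μ : Measure Ω)) :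
    μ ∈ closure (convexCombos A) := by
  classical
  refine mem_closure_of_integral_mem_closure (mem_closure_iff.2 fun o ho hμo => ?_)
  obtain ⟨I, u, hu, huo⟩ := isOpen_pi_iff.1 ho _ hμo
  set Ψ : ProbabilityMeasure Ω → I → ℝ := fun ν i => ∫ x, i.1 x ∂(ν : Measure Ω)
  have hcl : Ψ μ ∈ closure (convexHull ℝ (Ψ '' A)) := by
    by_contra hμ
    obtain ⟨f, c, hfμ, hf⟩ := geometric_hahn_banach_point_closed
      (convex_convexHull ℝ (Ψ '' A)).closure isClosed_closure hμ
    let k : Ω →ᵇ ℝ := ∑ i : I, f (Pi.single i 1) • i.1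
    have hk (ν : ProbabilityMeasure Ω) : ∫ x, k x ∂(ν : Measure Ω) = f (Ψ ν) := by
      have hf' : f (Ψ ν) = ∑ i : I, Ψ ν i • f (Pi.single i 1) := by
        conv_lhs => rw [← Finset.univ_sum_single (Ψ ν), map_sum]
        refine Finset.sum_congr rfl fun i _ => ?_
        rw [← map_smul, ← Pi.single_smul, smul_eq_mul, mul_one]
      rw [hf']
      simp only [k, BoundedContinuousFunction.coe_sum, Finset.sum_apply, coe_smul]
      rw [integral_finsetSum _ fun i _ => (i.1.integrable (ν : Measure Ω)).const_mul _]
      refine Finset.sum_congr rfl fun i _ => ?_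
      rw [integral_smul, smul_eq_mul, smul_eq_mul, mul_comm]
    obtain ⟨ν, hν, hle⟩ := h k
    rw [hk, hk] at hle
    have := hf _ (subset_closure (subset_convexHull ℝ _ (mem_image_of_mem Ψ hν)))
    linarith
  obtain ⟨z, hzu, hz⟩ := mem_closure_iff.1 hcl (univ.pi fun i : I => u i.1)
    (isOpen_set_pi finite_univ fun i _ => (hu i.1 i.2).1) fun i _ => (hu i.1 i.2).2
  obtain ⟨ν, hν, hνz⟩ := exists_convexCombos_of_mem_convexHull hz
  refine ⟨_, huo fun i hi => ?_, mem_image_of_mem _ hν⟩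
  have := hνz ⟨i, hi⟩
  simp only at this
  change ∫ x, i x ∂(ν : Measure Ω) ∈ u i
  rw [this]
  exact hzu ⟨i, hi⟩ (mem_univ _)

end ConvexHull

section Limit

open BoundedContinuousFunction

lemma exists_boundedContinuousFunction_eqOn {E : Type*} [TopologicalSpace E] [T2Space E]
    [NormalSpace E] {K : Set E} (hK : IsCompact K) {f : E → ℝ} (hf : ContinuousOn f K) :
    ∃ g : E →ᵇ ℝ, EqOn g f K := by
  have := isCompact_iff_compactSpace.1 hK
  obtain ⟨g, -, hg⟩ := exists_norm_eq_domRestrict_eq_of_closed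
    (mkOfCompact ⟨K.domRestrict f, hf.domRestrict⟩) hK.isClosed
  exact ⟨g, fun x hx => DFunLike.congr_fun hg ⟨x, hx⟩⟩

variable (M : Model n Uc S)

lemma isCompact_setOf_onG :
    IsCompact {μ : ProbabilityMeasure ((Fin n → ℝ) × Uc) | onG M μ} := by
  have h := isCompact_setOfPred_probabilityMeasure_mass_eq_compl_isCompact_le
    (u := fun _ => 0) (K := fun _ => graphG M) tendsto_const_nhds (fun _ => isCompact_graphG M)
    (.inl inferInstance)
  convert h using 3 with μ
  rw [onG, ← ProbabilityMeasure.ennreal_coeFn_eq_coeFn_toMeasure, ENNReal.coe_eq_zero,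
    nonpos_iff_eq_zero, forall_const]

lemma continuousOn_Ef (φ : (Fin n → ℝ) →ᵇ ℝ) :
    ContinuousOn (fun p : (Fin n → ℝ) × Uc => Ef M φ p.1 p.2) (graphG M) := by
  have := M.ν_prob
  refine continuousOn_of_dominated (bound := fun _ => ‖φ‖) (fun p hp => ?_)
    (fun p _ => .of_forall fun s => φ.norm_coe_le_norm _) (integrable_const _)
    (.of_forall fun s => ?_)
  · exact (φ.continuous.measurable.comp (M.f_meas _ hp.1 _)).aestronglyMeasurable
  · exact φ.continuous.comp_continuousOn ((M.f_cont s).mono fun p hp => ⟨hp.1, mem_univ _⟩)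

lemma exists_generator_extension (φ : (Fin n → ℝ) →ᵇ ℝ) :
    ∃ F : (Fin n → ℝ) × Uc →ᵇ ℝ, ∀ p ∈ graphG M, F p = Ef M φ p.1 p.2 - φ p.1 :=
  exists_boundedContinuousFunction_eqOn (isCompact_graphG M)
    ((continuousOn_Ef M φ).sub (φ.continuous.comp continuous_fst).continuousOn)

/-- A bounded continuous function equal to `E[φ(f(y,u,s))] - φ(y)` on the graph `G`. -/
def generatorExt (φ : (Fin n → ℝ) →ᵇ ℝ) : (Fin n → ℝ) × Uc →ᵇ ℝ :=
  (exists_generator_extension M φ).choose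

variable {M}

lemma generatorExt_of_mem (φ : (Fin n → ℝ) →ᵇ ℝ) {p : (Fin n → ℝ) × Uc}
    (hp : p ∈ graphG M) : generatorExt M φ p = Ef M φ p.1 p.2 - φ p.1 :=
  (exists_generator_extension M φ).choose_spec p hp

lemma integral_generatorExt_stateKernel (φ : (Fin n → ℝ) →ᵇ ℝ) (t : ℕ) (π : Plan M)
    {y : Fin n → ℝ} (hy : y ∈ M.Y) :
    ∫ z, generatorExt M φ (π.graphMap t z) ∂stateKernel t π y =
      ∫ z, φ z ∂stateKernel (t + 1) π y - ∫ z, φ z ∂stateKernel t π y := by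
  have hY : ∀ᵐ z ∂stateKernel t π y, z ∈ M.Y := stateKernel_compl_Y t π hy
  have hint : Integrable (fun z => ∫ x, φ x ∂π.kernel t z) (stateKernel t π y) :=
    Integrable.of_bound
      (φ.continuous.stronglyMeasurable.integral_kernel).aestronglyMeasurable ‖φ‖
      (.of_forall fun z => φ.norm_integral_le_norm _)
  rw [stateKernel_succ', Kernel.integral_comp (φ.integrable _),
    ← integral_sub hint (φ.integrable _)]
  refine integral_congr_ae ?_
  filter_upwards [hY] with z hz
  rw [generatorExt_of_mem φ (π.graphMap_mem t hz), π.kernel_apply,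
    integral_stepKernel (π.graphMap_mem t hz) φ.continuous]
  rfl

lemma abs_integral_generatorExt_occT_le (φ : (Fin n → ℝ) →ᵇ ℝ) (T : ℕ) (π : Plan M)
    {y : Fin n → ℝ} (hy : y ∈ M.Y) :
    |∫ p, generatorExt M φ p ∂occT M T π.π y| ≤ 2 * ‖φ‖ / T := by
  rw [integral_occT T π hy (generatorExt M φ).continuous.measurable
    (generatorExt M φ).norm_coe_le_norm]
  simp_rw [integral_generatorExt_stateKernel φ _ π hy]
  rw [Finset.sum_range_sub fun t => ∫ z, φ z ∂stateKernel t π y, abs_mul, abs_inv,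
    Nat.abs_cast, inv_mul_eq_div]
  gcongr
  refine (abs_sub _ _).trans ?_
  have h (t : ℕ) : |∫ z, φ z ∂stateKernel t π y| ≤ ‖φ‖ := φ.norm_integral_le_norm _
  linarith [h T, h 0]

variable (M) in
/-- Probability measures on `G` which are stationary up to an error of relative size `2 / T`. -/
def approxStationary (T : ℕ) : Set (ProbabilityMeasure ((Fin n → ℝ) × Uc)) :=
  {μ | onG M μ ∧ ∀ φ : (Fin n → ℝ) →ᵇ ℝ,
    |∫ p, generatorExt M φ p ∂(μ : Measure ((Fin n → ℝ) × Uc))| ≤ 2 * ‖φ‖ / T}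

lemma isCompact_approxStationary (T : ℕ) : IsCompact (approxStationary M T) := by
  refine (isCompact_setOf_onG M).inter_right
    (t := {μ : ProbabilityMeasure ((Fin n → ℝ) × Uc) | ∀ φ : (Fin n → ℝ) →ᵇ ℝ,
      |∫ p, generatorExt M φ p ∂(μ : Measure ((Fin n → ℝ) × Uc))| ≤ 2 * ‖φ‖ / T}) ?_
  simp only [ofPred_forall]
  refine isClosed_iInter fun φ => isClosed_le (Continuous.abs ?_) continuous_const
  exact ProbabilityMeasure.continuous_integral_boundedContinuousFunction _

lemma approxStationary_anti {T T' : ℕ} (hT : T ≠ 0) (h : T ≤ T') :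
    approxStationary M T' ⊆ approxStationary M T := by
  refine fun μ hμ => ⟨hμ.1, fun φ => (hμ.2 φ).trans ?_⟩
  have : (0 : ℝ) < T := by positivity
  gcongr

lemma mem_WsetPM_of_forall_mem_approxStationary
    {μ : ProbabilityMeasure ((Fin n → ℝ) × Uc)}
    (h : ∀ T, μ ∈ approxStationary M (T + 1)) : μ ∈ WsetPM M := by
  refine ⟨inferInstance, (h 0).1, fun φ hφ => ?_⟩
  obtain ⟨g, hg⟩ := exists_boundedContinuousFunction_eqOn M.Y_compact hφ.continuousOn
  have hG : ∀ᵐ p ∂(μ : Measure ((Fin n → ℝ) × Uc)), p ∈ graphG M := (h 0).1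
  have heq : ∫ p, (Ef M φ p.1 p.2 - φ p.1) ∂(μ : Measure ((Fin n → ℝ) × Uc)) =
      ∫ p, generatorExt M g p ∂(μ : Measure ((Fin n → ℝ) × Uc)) := by
    refine integral_congr_ae ?_
    filter_upwards [hG] with p hp
    rw [generatorExt_of_mem g hp, hg hp.1]
    congr 1
    exact integral_congr_ae (.of_forall fun s => (hg (M.f_inv _ hp.1 _ hp.2 s)).symm)
  have hlim : Tendsto (fun T : ℕ => 2 * ‖g‖ / ((T + 1 : ℕ) : ℝ)) atTop (𝓝 0) :=
    (tendsto_const_div_atTop_nhds_zero_nat _).comp (tendsto_add_atTop_nat 1)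
  rw [heq, ← abs_nonpos_iff]
  exact ge_of_tendsto' hlim fun T => (h T).2 g

lemma GammaTAll_subset_approxStationary (T : ℕ) :
    GammaTAll M T ⊆ approxStationary M T := by
  intro μ hμ
  obtain ⟨y, hy, π, hπ⟩ := mem_iUnion₂.1 hμ
  refine ⟨hπ ▸ occT_onG T π hy, fun φ => hπ ▸ abs_integral_generatorExt_occT_le φ T π hy⟩

lemma convexCombos_subset_approxStationary {T : ℕ}
    {A : Set (ProbabilityMeasure ((Fin n → ℝ) × Uc))} (hA : A ⊆ approxStationary M T) :
    convexCombos A ⊆ approxStationary M T := by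
  rintro μ ⟨m, w, γ, hγ, hw, hμ⟩
  refine ⟨?_, fun φ => ?_⟩
  · have h (i : Fin m) : (γ i).toMeasure (graphG M)ᶜ = 0 := (hA (hγ i)).1
    simp [onG, hμ, h]
  · rw [hμ, integral_finsetSum_measure fun i _ =>
      ((generatorExt M φ).integrable (γ i).toMeasure).smul_measure ENNReal.coe_ne_top]
    simp only [integral_smul_measure, ENNReal.coe_toReal, smul_eq_mul]
    calc _ ≤ ∑ i, |(w i : ℝ) * ∫ p, generatorExt M φ p ∂(γ i).toMeasure| :=
          Finset.abs_sum_le_sum_abs _ _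
      _ ≤ ∑ i, (w i : ℝ) * (2 * ‖φ‖ / T) := by
          gcongr with i
          rw [abs_mul, NNReal.abs_eq]
          gcongr
          exact (hA (hγ i)).2 φ
      _ = 2 * ‖φ‖ / T := by
          rw [← Finset.sum_mul, ← NNReal.coe_sum, hw, NNReal.coe_one, one_mul]

lemma closure_convexCombos_GammaTAll_subset (T : ℕ) :
    closure (convexCombos (GammaTAll M T)) ⊆ approxStationary M T :=
  closure_minimal (convexCombos_subset_approxStationary (GammaTAll_subset_approxStationary T))
    (isCompact_approxStationary T).isClosed

lemma WsetPM_subset_closure_convexCombos [Nonempty (Plan M)] {T : ℕ} (hT : T ≠ 0) :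
    WsetPM M ⊆ closure (convexCombos (GammaTAll M T)) := by
  refine fun μ hμ => mem_closure_convexCombos fun k => ?_
  obtain ⟨π, y, hy, h⟩ := exists_integral_occT_le k.continuous.measurable k.norm_coe_le_norm
    hμ hT
  exact ⟨⟨_, isProbabilityMeasure_occT hT π hy⟩, mem_iUnion₂.2 ⟨y, hy, π, rfl⟩, h⟩

lemma eventually_approxStationary_subset {O : Set (ProbabilityMeasure ((Fin n → ℝ) × Uc))}
    (hO : IsOpen O) (hWO : WsetPM M ⊆ O) : ∀ᶠ T in atTop, approxStationary M T ⊆ O := by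
  have hanti : Antitone fun T => approxStationary M (T + 1) :=
    fun T T' h => approxStationary_anti T.succ_ne_zero (by lia)
  obtain ⟨T, hT⟩ := exists_subset_nhds_of_isCompact' (directed_of_isDirected_le hanti)
    (fun T => isCompact_approxStationary (T + 1))
    (fun T => (isCompact_approxStationary (T + 1)).isClosed)
    fun μ hμ => hO.mem_nhds
      (hWO (mem_WsetPM_of_forall_mem_approxStationary (mem_iInter.1 hμ)))
  filter_upwards [eventually_ge_atTop (T + 1)] with T' hT'
  exact (approxStationary_anti T.succ_ne_zero hT').trans hT

lemma convexCombos_empty {α : Type*} [MeasurableSpace α] :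
    convexCombos (∅ : Set (ProbabilityMeasure α)) = ∅ := by
  refine eq_empty_iff_forall_notMem.2 ?_
  rintro μ ⟨m, w, γ, hγ, hw, -⟩
  have : IsEmpty (Fin m) := ⟨fun i => hγ i⟩
  simp at hw

end Limit

/-- `lim_{T→∞} ρ_H( cl co Γ_T , W ) = 0`, where `Γ_T = ∪_{y₀∈Y} Γ_T(y₀)` and
`ρ_H` is the Hausdorff (semi)metric associated with any metric on the space of probability
measures on `G` that metrizes the weak* topology. -/
theorem statement4 (M : Model n Uc S)
    (mρ : MetricSpace (ProbabilityMeasure ((Fin n → ℝ) × Uc)))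
    (hmρ : mρ.toPseudoMetricSpace.toUniformSpace.toTopologicalSpace =
      (inferInstance : TopologicalSpace (ProbabilityMeasure ((Fin n → ℝ) × Uc)))) :
    Tendsto (fun T : ℕ =>
        @Metric.hausdorffDist _ mρ.toPseudoMetricSpace
          (closure (convexCombos (GammaTAll M T))) (WsetPM M))
      atTop (𝓝 0) := by
  rcases isEmpty_or_nonempty (Plan M) with hM | hM
  · have h (T : ℕ) : GammaTAll M T = ∅ := by
      refine eq_empty_iff_forall_notMem.2 fun μ hμ => ?_
      obtain ⟨y, hy, π, -⟩ := mem_iUnion₂.1 hμ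
      exact hM.elim π
    simp only [h, convexCombos_empty, closure_empty]
    simp only [@Metric.hausdorffDist_empty' _ mρ.toPseudoMetricSpace, tendsto_const_nhds]
  have hO (ε : ℝ) : IsOpen (⋃ w ∈ WsetPM M, @Metric.ball _ mρ.toPseudoMetricSpace w ε) := by
    refine isOpen_biUnion fun w _ => ?_
    have := @Metric.isOpen_ball _ mρ.toPseudoMetricSpace w ε
    rwa [hmρ] at this
  refine Metric.tendsto_nhds.2 fun ε hε => ?_
  have hsub : WsetPM M ⊆ ⋃ w ∈ WsetPM M, @Metric.ball _ mρ.toPseudoMetricSpace w (ε / 2) :=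
    fun w hw => mem_iUnion₂.2
      ⟨w, hw, @Metric.mem_ball_self _ mρ.toPseudoMetricSpace _ _ (half_pos hε)⟩
  filter_upwards [eventually_approxStationary_subset (hO _) hsub, eventually_ge_atTop 1]
    with T hT hT1
  rw [Real.dist_0_eq_abs, abs_of_nonneg (@Metric.hausdorffDist_nonneg _ mρ.toPseudoMetricSpace _ _)]
  refine (@Metric.hausdorffDist_le_of_mem_dist _ mρ.toPseudoMetricSpace _ _ (ε / 2)
    (half_pos hε).le (fun μ hμ => ?_) fun μ hμ => ?_).trans_lt (half_lt_self hε)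
  · obtain ⟨w, hw, hμw⟩ := mem_iUnion₂.1 (hT (closure_convexCombos_GammaTAll_subset T hμ))
    exact ⟨w, hw, (@Metric.mem_ball _ mρ.toPseudoMetricSpace _ _ _ |>.1 hμw).le⟩
  · refine ⟨μ, WsetPM_subset_closure_convexCombos (by lia) hμ, ?_⟩
    rw [@dist_self _ mρ.toPseudoMetricSpace]
    exact (half_pos hε).le

end StochLP
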